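/- arXiv:2309.05387 — 3 statements merged into one kernel-verified Lean document; each statement's English description precedes it below -/
import Mathlib

section
/- Let g ≥ 1 and l ≥ 1, and let w₀, w₁, …, w_l and t₁, …, t_l be elements of the free group F_g. Consider the set 𝒜 = { (k₁,…,k_l) ∈ ℤ^l : w₀ · t₁^{k₁} · w₁ · t₂^{k₂} · w₂ ⋯ t_l^{k_l} · w_l = 1 in F_g }. Then 𝒜 is a finite union of affine images of nonnegative orthants: there exist N ∈ ℕ and, for each j ∈ {1,…,N}, a vector z_j ∈ ℤ^l, a natural number d_j, and an l×d_j integer matrix M_j, such that 𝒜 = ⋃_{j=1}^{N} { z_j + M_j·v : v ∈ ℤ_{≥0}^{d_j} }. -/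
open Set Pointwise

namespace ExpEq

/-! ### Commutative regular expressions and Parikh's theorem -/

/-- Regular expressions over semilinear sets with variables in `V`. -/
inductive RegEx (M : Type) [AddCommMonoid M] (V : Type) : Type
  | const (s : Set M) (hs : IsSemilinearSet s) : RegEx M V
  | var (v : V) : RegEx M V
  | union (e f : RegEx M V) : RegEx M V
  | add (e f : RegEx M V) : RegEx M V
  | star (e : RegEx M V) : RegEx M V

variable {M : Type} [AddCommMonoid M] {V W : Type}

namespace RegEx

/-- Evaluation of an expression. -/
def ev (x : V → Set M) : RegEx M V → Set M
  | const s _ => s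
  | var v => x v
  | union e f => ev x e ∪ ev x f
  | add e f => ev x e + ev x f
  | star e => (AddSubmonoid.closure (ev x e) : Set M)

/-- Substitution. -/
def bind (σ : V → RegEx M W) : RegEx M V → RegEx M W
  | const s hs => const s hs
  | var v => σ v
  | union e f => union (bind σ e) (bind σ f)
  | add e f => add (bind σ e) (bind σ f)
  | star e => star (bind σ e)

theorem ev_bind (σ : V → RegEx M W) (x : W → Set M) (e : RegEx M V) :
    ev x (bind σ e) = ev (fun v => ev x (σ v)) e := by
  induction e <;> simp_all [bind, ev]

theorem ev_mono {x y : V → Set M} (h : ∀ v, x v ⊆ y v) (e : RegEx M V) :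
    ev x e ⊆ ev y e := by
  induction e with
  | const s hs => exact subset_rfl
  | var v => exact h v
  | union e f he hf => exact union_subset_union he hf
  | add e f he hf => exact add_subset_add he hf
  | star e he => exact AddSubmonoid.closure_mono he

theorem ev_semilinear {x : V → Set M} (h : ∀ v, IsSemilinearSet (x v)) (e : RegEx M V) :
    IsSemilinearSet (ev x e) := by
  induction e with
  | const s hs => exact hs
  | var v => exact h v
  | union e f he hf => exact he.union hf
  | add e f he hf => exact he.add hf
  | star e he => exact he.closure

/-- Formal quotient by the distinguished variable `none`. -/
def quo : RegEx M (Option V) → RegEx M (Option V)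
  | const _ _ => const ∅ .empty
  | var none => const {0} (.singleton 0)
  | var (some _) => const ∅ .empty
  | union e f => union (quo e) (quo f)
  | add e f => union (add e (quo f)) (add (quo e) f)
  | star e => add (star e) (quo e)

/-- Assignment on `Option V`. -/
def asg (a : Set M) (x : V → Set M) : Option V → Set M
  | none => a
  | some v => x v

theorem asg_mono {a b : Set M} (h : a ⊆ b) {x y : V → Set M} (hxy : ∀ v, x v ⊆ y v) (o : Option V) :
    asg a x o ⊆ asg b y o := by
  cases o with
  | none => exact h
  | some v => exact hxy v

theorem quo_le (a : Set M) (x : V → Set M) (e : RegEx M (Option V)) :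
    ev (asg a x) (quo e) + a ⊆ ev (asg a x) e := by
  induction e with
  | const s hs => simp [quo, ev]
  | var v => cases v <;> simp [quo, ev, asg]
  | union e f he hf =>
    simp only [quo, ev, union_add]
    exact union_subset_union he hf
  | add e f he hf =>
    simp only [quo, ev, union_add]
    refine union_subset ?_ ?_
    · rw [add_assoc]; exact add_subset_add subset_rfl hf
    · rw [add_right_comm]; exact add_subset_add he subset_rfl
  | star e he =>
    simp only [quo, ev]
    rw [add_assoc]
    rintro _ ⟨p, hp, q, hq, rfl⟩
    exact add_mem hp (AddSubmonoid.subset_closure (he hq))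

theorem le_quo (a : Set M) (x : V → Set M) (e : RegEx M (Option V)) :
    ev (asg a x) e ⊆ ev (asg ∅ x) e ∪ (ev (asg a x) (quo e) + a) := by
  induction e with
  | const s hs => simp [ev]
  | var v => cases v <;> simp [quo, ev, asg]
  | union e f he hf =>
    simp only [quo, ev, union_add]
    intro p hp
    rcases hp with hp | hp
    · rcases he hp with h | h
      · exact Or.inl (Or.inl h)
      · exact Or.inr (Or.inl h)
    · rcases hf hp with h | h
      · exact Or.inl (Or.inr h)
      · exact Or.inr (Or.inr h)
  | add e f he hf =>
    simp only [quo, ev, union_add]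
    rintro _ ⟨p, hp, q, hq, rfl⟩
    rcases he hp with h | h
    · rcases hf hq with h' | h'
      · exact Or.inl (add_mem_add h h')
      · refine Or.inr (Or.inl ?_)
        rw [add_assoc]
        exact add_mem_add hp h'
    · refine Or.inr (Or.inr ?_)
      rw [add_right_comm]
      exact add_mem_add h hq
  | star e he =>
    simp only [quo, ev]
    intro p hp
    induction hp using AddSubmonoid.closure_induction_left with
    | zero => exact Or.inl (zero_mem _)
    | add_left s hs t ht ih =>
      rcases he hs with h | h
      · rcases ih with h' | h'
        · exact Or.inl (add_mem (AddSubmonoid.subset_closure h) h')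
        · refine Or.inr ?_
          rw [add_assoc] at h' ⊢
          obtain ⟨c, hc, d, hd, rfl⟩ := h'
          refine ⟨s + c, add_mem (AddSubmonoid.subset_closure hs) hc, d, hd, ?_⟩
          exact add_assoc _ _ _
      · refine Or.inr ?_
        rw [add_assoc, add_comm s t]
        exact add_mem_add ht h

theorem ev_star_le (a y : Set M) (x : V → Set M) (e : RegEx M (Option V)) :
    ev (asg ((AddSubmonoid.closure y : Set M) + a) x) e ⊆
      ev (asg a x) e + (AddSubmonoid.closure y : Set M) := by
  have h0 : ∀ s : Set M, s ⊆ s + (AddSubmonoid.closure y : Set M) := fun s p hp =>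
    ⟨p, hp, 0, zero_mem _, add_zero p⟩
  induction e with
  | const s hs => exact h0 s
  | var v =>
    cases v with
    | none => simp only [ev, asg]; rw [add_comm]
    | some v => exact h0 _
  | union e f he hf =>
    simp only [ev, union_add]
    exact union_subset_union he hf
  | add e f he hf =>
    simp only [ev]
    rintro _ ⟨p, hp, q, hq, rfl⟩
    obtain ⟨a, ha, b, hb, rfl⟩ := he hp
    obtain ⟨c, hc, d, hd, rfl⟩ := hf hq
    exact ⟨a + c, add_mem_add ha hc, b + d, add_mem hb hd, add_add_add_comm _ _ _ _⟩
  | star e he =>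
    simp only [ev]
    rw [← AddSubmonoid.coe_sup]
    refine SetLike.coe_subset_coe.2 (AddSubmonoid.closure_le.2 (he.trans ?_))
    rw [AddSubmonoid.coe_sup]
    exact add_subset_add AddSubmonoid.subset_closure subset_rfl

/-- Substitution for the distinguished variable. -/
def sub (e : RegEx M V) : Option V → RegEx M V
  | none => e
  | some v => var v

theorem ev_sub (e : RegEx M V) (f : RegEx M (Option V)) (x : V → Set M) :
    ev x (bind (sub e) f) = ev (asg (ev x e) x) f := by
  rw [ev_bind]
  congr 1
  funext o
  cases o <;> rfl

/-- Solution of a one-variable equation. -/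
def sol (f : RegEx M (Option V)) : RegEx M V :=
  add (star (bind (sub (bind (sub (const ∅ .empty)) f)) (quo f))) (bind (sub (const ∅ .empty)) f)

theorem ev_sol (f : RegEx M (Option V)) (x : V → Set M) :
    ev x (sol f) = (AddSubmonoid.closure (ev (asg (ev (asg ∅ x) f) x) (quo f)) : Set M) +
      ev (asg ∅ x) f := by
  simp only [sol, ev, ev_sub]

theorem sol_closed (f : RegEx M (Option V)) (x : V → Set M) :
    ev (asg (ev x (sol f)) x) f ⊆ ev x (sol f) := by
  rw [ev_sol]
  set a := ev (asg ∅ x) f with ha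
  set y := ev (asg a x) (quo f) with hy
  refine (le_quo _ x f).trans (union_subset ?_ ?_)
  · intro p hp
    exact ⟨0, zero_mem _, p, hp, zero_add p⟩
  · rw [← add_assoc]
    refine add_subset_add ?_ subset_rfl
    rintro _ ⟨p, hp, q, hq, rfl⟩
    obtain ⟨c, hc, d, hd, rfl⟩ := ev_star_le a y x (quo f) hp
    exact add_mem (add_mem (AddSubmonoid.subset_closure hc) hd) hq

theorem sol_least (f : RegEx M (Option V)) (x : V → Set M) (b : Set M)
    (hb : ev (asg b x) f ⊆ b) : ev x (sol f) ⊆ b := by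
  rw [ev_sol]
  have hab : ev (asg ∅ x) f ⊆ b :=
    (ev_mono (asg_mono (empty_subset b) fun _ => subset_rfl) f).trans hb
  rintro _ ⟨p, hp, q, hq, rfl⟩
  have hq := hab hq
  revert q
  induction hp using AddSubmonoid.closure_induction_left with
  | zero => intro q _ hq; simpa using hq
  | add_left s hs t ht ih =>
    intro q hq0 hq
    have h1 := ih q hq0 hq
    have h2 := ev_mono (asg_mono hab fun v => Subset.refl (x v)) (quo f) hs
    have := hb (quo_le b x f (add_mem_add h2 h1))
    simpa [add_assoc] using this

end RegEx

open RegEx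

/-- Every finite system has a semilinear least (pre)fixed point. -/
theorem exists_least (V : Type) [Finite V] : ∀ f : V → RegEx M V,
    ∃ c : V → Set M, (∀ v, IsSemilinearSet (c v)) ∧ (∀ v, ev c (f v) ⊆ c v) ∧
      ∀ x : V → Set M, (∀ v, ev x (f v) ⊆ x v) → ∀ v, c v ⊆ x v := by
  induction V using Finite.induction_empty_option with
  | of_equiv e ih =>
    rename_i α β
    intro f
    obtain ⟨c, h1, h2, h3⟩ := ih fun a => bind (fun b => var (e.symm b)) (f (e a))
    have key : ∀ (x : α → Set M) (g : RegEx M β),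
        ev x (bind (fun b => var (e.symm b)) g) = ev (fun b => x (e.symm b)) g := by
      intro x g
      rw [ev_bind]
      rfl
    refine ⟨fun b => c (e.symm b), fun b => h1 _, fun b => ?_, fun x hx b => ?_⟩
    · have := h2 (e.symm b)
      rw [key] at this
      simpa using this
    · have := h3 (fun a => x (e a)) (fun a => ?_) (e.symm b)
      · simpa using this
      · rw [key]
        simpa using hx (e a)
  | h_empty =>
    intro f
    exact ⟨fun _ => ∅, fun v => v.elim, fun v => v.elim, fun _ _ v => v.elim⟩
  | h_option ih =>
    rename_i α _
    intro f
    obtain ⟨c, h1, h2, h3⟩ := ih fun a => bind (sub (sol (f none))) (f (some a))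
    refine ⟨asg (ev c (sol (f none))) c, ?_, ?_, ?_⟩
    · rintro (_ | a)
      · exact ev_semilinear h1 _
      · exact h1 a
    · rintro (_ | a)
      · exact sol_closed _ _
      · have := h2 a
        rwa [ev_sub] at this
    · intro x hx
      have hxe : x = asg (x none) (fun a => x (some a)) := by
        funext o; cases o <;> rfl
      have h4 : ev (fun a => x (some a)) (sol (f none)) ⊆ x none := by
        apply sol_least
        rw [← hxe]
        exact hx none
      have h5 : ∀ a, c a ⊆ x (some a) := by
        apply h3
        intro a
        rw [ev_sub]
        refine Subset.trans ?_ (hx (some a))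
        conv_rhs => rw [hxe]
        exact ev_mono (asg_mono h4 fun _ => subset_rfl) _
      rintro (_ | a)
      · exact (ev_mono h5 _).trans h4
      · exact h5 a

/-- Finite unions of expressions. -/
def listUnion : List (RegEx M V) → RegEx M V
  | [] => const ∅ .empty
  | e :: L => union e (listUnion L)

theorem mem_listUnion (x : V → Set M) (L : List (RegEx M V)) (p : M) :
    p ∈ ev x (listUnion L) ↔ ∃ e ∈ L, p ∈ ev x e := by
  induction L with
  | nil => simp [listUnion, ev]
  | cons e L ih => simp [listUnion, ev, ih]

/-! ### Derivations for weighted automata over a free group -/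

section Derivations

variable {Q α : Type} (Lett : Q → α × Bool → Q → Prop) (Eps : Q → Q → Set M)

/-- `D p q v`: there is a path from `p` to `q` of weight `v` whose label is trivial. -/
inductive D : Q → Q → M → Prop
  | refl (p : Q) : D p p 0
  | eps {p q : Q} {v : M} : v ∈ Eps p q → D p q v
  | trans {p r q : Q} {v v' : M} : D p r v → D r q v' → D p q (v + v')
  | lett {p p' q' q : Q} {x : α} {b : Bool} {v : M} :
      Lett p (x, b) p' → Lett q' (x, !b) q → D p' q' v → D p q v

theorem D_semilinear [Finite Q] (hE : ∀ p q, IsSemilinearSet (Eps p q)) (p q : Q) :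
    IsSemilinearSet {v | D Lett Eps p q v} := by
  classical
  have := Fintype.ofFinite Q
  have hC : ∀ z : Q × Q, IsSemilinearSet (Eps z.1 z.2 ∪ {v | v = 0 ∧ z.1 = z.2}) := fun z =>
    (hE _ _).union (.of_finite ((finite_singleton (0 : M)).subset fun v hv => hv.1))
  let F : Q × Q → RegEx M (Q × Q) := fun z =>
    union (const _ (hC z)) (union
      (listUnion ((Finset.univ : Finset Q).toList.map fun r => add (var (z.1, r)) (var (r, z.2))))
      (listUnion ((Finset.univ : Finset (Q × Q)).toList.map fun y =>
        if ∃ x b, Lett z.1 (x, b) y.1 ∧ Lett y.2 (x, !b) z.2 then var y else const ∅ .empty)))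
  have hF : ∀ (x : Q × Q → Set M) (z : Q × Q) (v : M), v ∈ ev x (F z) ↔
      ((v ∈ Eps z.1 z.2 ∨ (v = 0 ∧ z.1 = z.2)) ∨ (∃ r, v ∈ x (z.1, r) + x (r, z.2)) ∨
        ∃ y : Q × Q, (∃ a b, Lett z.1 (a, b) y.1 ∧ Lett y.2 (a, !b) z.2) ∧ v ∈ x y) := by
    intro x z v
    refine or_congr Iff.rfl (or_congr ?_ ?_)
    · rw [mem_listUnion]
      simp [ev]
    · rw [mem_listUnion]
      simp only [List.mem_map, Finset.mem_toList, Finset.mem_univ, true_and]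
      constructor
      · rintro ⟨e, ⟨y, rfl⟩, h⟩
        refine ⟨y, ?_⟩
        split_ifs at h with hc
        · exact ⟨hc, h⟩
        · exact h.elim
      · rintro ⟨y, hc, h⟩
        exact ⟨_, ⟨y, rfl⟩, by rw [if_pos hc]; exact h⟩
  obtain ⟨c, h1, h2, h3⟩ := exists_least (Q × Q) F
  have : {v | D Lett Eps p q v} = c (p, q) := by
    apply Subset.antisymm
    · intro v hv
      induction hv with
      | refl p => exact h2 _ ((hF _ _ _).2 (Or.inl (Or.inr ⟨rfl, rfl⟩)))
      | eps h => exact h2 _ ((hF _ _ _).2 (Or.inl (Or.inl h)))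
      | trans _ _ ih1 ih2 =>
        exact h2 _ ((hF _ _ _).2 (Or.inr (Or.inl ⟨_, add_mem_add ih1 ih2⟩)))
      | lett ha hb _ ih =>
        exact h2 _ ((hF _ _ _).2 (Or.inr (Or.inr ⟨(_, _), ⟨_, _, ha, hb⟩, ih⟩)))
    · refine h3 (fun z => {v | D Lett Eps z.1 z.2 v}) ?_ (p, q)
      rintro ⟨p, q⟩ v hv
      rw [hF] at hv
      rcases hv with (h | ⟨rfl, h⟩) | ⟨r, a, ha, b, hb, rfl⟩ | ⟨y, ⟨a, b, h, h'⟩, hy⟩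
      · exact .eps h
      · simp only at h
        subst h
        exact .refl _
      · exact .trans ha hb
      · exact .lett h h' hy
  rw [this]
  exact h1 _

/-- Paths with saturated silent moves. -/
inductive Pth : Q → Q → List (α × Bool) → M → Prop
  | nil {p q : Q} {v : M} : D Lett Eps p q v → Pth p q [] v
  | cons {p p' r q : Q} {a : α × Bool} {L : List (α × Bool)} {v v' : M} :
      D Lett Eps p p' v → Lett p' a r → Pth r q L v' → Pth p q (a :: L) (v + v')

variable {Lett Eps}

theorem Pth.absorb {p r q : Q} {L : List (α × Bool)} {v v' : M} (h : D Lett Eps p r v)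
    (h' : Pth Lett Eps r q L v') : Pth Lett Eps p q L (v + v') := by
  cases h' with
  | nil h' => exact .nil (h.trans h')
  | cons h1 h2 h3 =>
    rw [← add_assoc]
    exact .cons (h.trans h1) h2 h3

theorem Pth.append {p r q : Q} {L L' : List (α × Bool)} {v v' : M} (h : Pth Lett Eps p r L v)
    (h' : Pth Lett Eps r q L' v') : Pth Lett Eps p q (L ++ L') (v + v') := by
  induction h with
  | nil h => exact h'.absorb h
  | cons h1 h2 _ ih =>
    rw [add_assoc]
    exact .cons h1 h2 (ih h')

theorem Pth.step {L₁ L₂ : List (α × Bool)} {x : α} {b : Bool} : ∀ {p q : Q} {v : M},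
    Pth Lett Eps p q (L₁ ++ (x, b) :: (x, !b) :: L₂) v → Pth Lett Eps p q (L₁ ++ L₂) v := by
  induction L₁ with
  | nil =>
    intro p q v h
    cases h with
    | cons h1 h2 h3 =>
      cases h3 with
      | cons h4 h5 h6 =>
        rw [← add_assoc]
        exact h6.absorb (h1.trans (.lett h2 h5 h4))
  | cons a L ih =>
    intro p q v h
    cases h with
    | cons h1 h2 h3 => exact .cons h1 h2 (ih h3)

theorem Pth.red {L L' : List (α × Bool)} (hL : FreeGroup.Red L L') {p q : Q} {v : M}
    (h : Pth Lett Eps p q L v) : Pth Lett Eps p q L' v := by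
  induction hL with
  | refl => exact h
  | tail _ hs ih =>
    cases hs
    exact ih.step

variable (Lett Eps)

/-- Paths labelled by a group element. -/
def HP (p q : Q) (x : FreeGroup α) (v : M) : Prop :=
  ∃ L, FreeGroup.mk L = x ∧ Pth Lett Eps p q L v

variable {Lett Eps}

theorem HP.mul {p r q : Q} {x y : FreeGroup α} {v v' : M} (h : HP Lett Eps p r x v)
    (h' : HP Lett Eps r q y v') : HP Lett Eps p q (x * y) (v + v') := by
  obtain ⟨L, rfl, h⟩ := h
  obtain ⟨L', rfl, h'⟩ := h'
  exact ⟨L ++ L', FreeGroup.mul_mk.symm, h.append h'⟩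

theorem HP.ofD {p q : Q} {v : M} (h : D Lett Eps p q v) : HP Lett Eps p q 1 v :=
  ⟨[], rfl, .nil h⟩

theorem HP.ofLett {p q : Q} {a : α × Bool} (h : Lett p a q) :
    HP Lett Eps p q (FreeGroup.mk [a]) 0 :=
  ⟨[a], rfl, by simpa using Pth.cons (.refl p) h (.nil (.refl (Eps := Eps) q))⟩

theorem HP.toD {p q : Q} {v : M} (h : HP Lett Eps p q 1 v) : D Lett Eps p q v := by
  classical
  obtain ⟨L, hL, h⟩ := h
  have h1 : FreeGroup.Red L [] := by
    have h2 : FreeGroup.Red L (FreeGroup.reduce L) := FreeGroup.reduce.red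
    rw [← FreeGroup.toWord_mk, hL, FreeGroup.toWord_one] at h2
    exact h2
  have h3 := h.red h1
  cases h3 with
  | nil h => exact h

end Derivations

/-! ### The concrete automaton -/

section Concrete

variable (α : Type) [DecidableEq α] (l B : ℕ) (tt ww : ℕ → FreeGroup α)

/-- States: a hub together with the word still to be read before arriving there. -/
abbrev St : Type := Fin (l + 1) × {u : List (α × Bool) // u.length ≤ B}

variable {α l B}

/-- Letter moves. -/
def LetterMove (p : St α l B) (a : α × Bool) (q : St α l B) : Prop :=
  p.1 = q.1 ∧ p.2.1 = a :: q.2.1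

/-- Silent moves. -/
def Ep (p q : St α l B) : Set (ℕ → ℤ) :=
  {v | p.2.1 = [] ∧
    ((p.1 = q.1 ∧ q.2.1 = (tt q.1).toWord ∧ v = Pi.single (q.1 : ℕ) 1) ∨
     (p.1 = q.1 ∧ q.2.1 = (tt q.1)⁻¹.toWord ∧ v = Pi.single (q.1 : ℕ) (-1)) ∨
     ((q.1 : ℕ) = p.1 + 1 ∧ q.2.1 = (ww q.1).toWord ∧ v = 0))}

theorem Ep_semilinear (p q : St α l B) : IsSemilinearSet (Ep tt ww p q) := by
  refine .of_finite ((Set.toFinite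
    {Pi.single (q.1 : ℕ) 1, Pi.single (q.1 : ℕ) (-1), (0 : ℕ → ℤ)}).subset ?_)
  rintro v ⟨_, ⟨_, _, h⟩ | ⟨_, _, h⟩ | ⟨_, _, h⟩⟩ <;> simp [h]

/-- Partial products. -/
def PP (y : ℕ → ℤ) : ℕ → FreeGroup α
  | 0 => ww 0
  | n + 1 => PP y n * tt n ^ y n * ww (n + 1)

theorem PP_congr {y y' : ℕ → ℤ} {n : ℕ} (h : ∀ j < n, y j = y' j) :
    PP tt ww y n = PP tt ww y' n := by
  induction n with
  | zero => rfl
  | succ n ih =>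
    simp only [PP]
    rw [ih fun j hj => h j (by omega), h n (by omega)]

theorem PP_eq (y : ℕ → ℤ) (n : ℕ) :
    PP tt ww y n = ww 0 * (List.ofFn fun i : Fin n => tt i ^ y i * ww (i + 1)).prod := by
  induction n with
  | zero => simp [PP]
  | succ n ih =>
    rw [List.ofFn_succ', List.prod_concat, PP, ih]
    simp [mul_assoc]

/-- The invariant. -/
def Inv (p : St α l B) (y : ℕ → ℤ) (x : FreeGroup α) : Prop :=
  (∀ j, (p.1 : ℕ) < j → y j = 0) ∧
    x * FreeGroup.mk p.2.1 = PP tt ww y p.1 * tt p.1 ^ y p.1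

theorem sound {p q : St α l B} {v : ℕ → ℤ} (h : D LetterMove (Ep tt ww) p q v) :
    ∀ y x, Inv tt ww p y x → Inv tt ww q (y + v) x := by
  induction h with
  | refl p => intro y x h; simpa using h
  | trans _ _ ih1 ih2 =>
    intro y x h
    rw [← add_assoc]
    exact ih2 _ _ (ih1 _ _ h)
  | @lett p p' q' q a b v h1 h2 _ ih =>
    rintro y x ⟨h3, h4⟩
    obtain ⟨h5, h6⟩ := ih y (x * FreeGroup.mk [(a, b)])
      ⟨by rw [← h1.1]; exact h3, by
        rw [← h1.1, ← h4, h1.2, mul_assoc, FreeGroup.mul_mk]; rfl⟩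
    rw [h2.1] at h5 h6
    refine ⟨h5, ?_⟩
    rw [← h6, h2.2, mul_assoc, FreeGroup.mul_mk]
    congr 1
    exact (Quot.sound (FreeGroup.Red.Step.cons_not)).symm
  | @eps p q v h =>
    rintro y x ⟨h3, h4⟩
    obtain ⟨h0, h | h | h⟩ := h
    · obtain ⟨h1, h2, rfl⟩ := h
      rw [h0, h1] at h4
      rw [h1] at h3
      refine ⟨fun j hj => ?_, ?_⟩
      · simp [h3 j hj, hj.ne']
      · have hx : x = _ := (mul_one x).symm.trans h4
        rw [h2, FreeGroup.mk_toWord, hx, PP_congr tt ww (y := y + _) (y' := y)]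
        · simp [mul_assoc, zpow_add_one]
        · intro j hj; simp [hj.ne]
    · obtain ⟨h1, h2, rfl⟩ := h
      rw [h0, h1] at h4
      rw [h1] at h3
      refine ⟨fun j hj => ?_, ?_⟩
      · simp [h3 j hj, hj.ne']
      · have hx : x = _ := (mul_one x).symm.trans h4
        rw [h2, FreeGroup.mk_toWord, hx, PP_congr tt ww (y := y + _) (y' := y)]
        · simp [mul_assoc, zpow_add]
        · intro j hj; simp [hj.ne]
    · obtain ⟨h1, h2, rfl⟩ := h
      rw [h0] at h4
      have hx : x = _ := (mul_one x).symm.trans h4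
      refine ⟨fun j hj => ?_, ?_⟩
      · simpa using h3 j (by omega)
      · rw [h2, FreeGroup.mk_toWord, hx, h1, add_zero, h3 _ (Nat.lt_succ_self _), zpow_zero, mul_one]
        rfl

theorem read (i : Fin (l + 1)) : ∀ (u : List (α × Bool)) (hu : u.length ≤ B),
    HP LetterMove (Ep tt ww) ((i, ⟨u, hu⟩) : St α l B) (i, ⟨[], Nat.zero_le _⟩) (FreeGroup.mk u) 0
  | [], _ => HP.ofD (.refl _)
  | a :: u, hu => by
    have hu' : u.length ≤ B := by simp at hu; omega
    have h1 : HP LetterMove (Ep tt ww) ((i, ⟨a :: u, hu⟩) : St α l B) (i, ⟨u, hu'⟩) (FreeGroup.mk [a]) 0 :=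
      HP.ofLett ⟨rfl, rfl⟩
    simpa [FreeGroup.mul_mk] using h1.mul (read i u hu')

theorem loop (i : Fin (l + 1)) (h1 : (tt i).toWord.length ≤ B) (h2 : (tt i)⁻¹.toWord.length ≤ B)
    (k : ℤ) :
    HP LetterMove (Ep tt ww) ((i, ⟨[], Nat.zero_le _⟩) : St α l B) (i, ⟨[], Nat.zero_le _⟩)
      (tt i ^ k) (Pi.single (i : ℕ) k) := by
  have hp : HP LetterMove (Ep tt ww) ((i, ⟨[], Nat.zero_le _⟩) : St α l B) (i, ⟨[], Nat.zero_le _⟩)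
      (tt i) (Pi.single (i : ℕ) 1) := by
    have a1 : HP LetterMove (Ep tt ww) ((i, ⟨[], Nat.zero_le _⟩) : St α l B) (i, ⟨(tt i).toWord, h1⟩)
      1 (Pi.single (i : ℕ) 1) := HP.ofD (.eps ⟨rfl, Or.inl ⟨rfl, rfl, rfl⟩⟩)
    have := a1.mul (read tt ww i _ h1)
    rwa [one_mul, add_zero, FreeGroup.mk_toWord] at this
  have hm : HP LetterMove (Ep tt ww) ((i, ⟨[], Nat.zero_le _⟩) : St α l B) (i, ⟨[], Nat.zero_le _⟩)
      (tt i)⁻¹ (Pi.single (i : ℕ) (-1)) := by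
    have a1 : HP LetterMove (Ep tt ww) ((i, ⟨[], Nat.zero_le _⟩) : St α l B) (i, ⟨(tt i)⁻¹.toWord, h2⟩)
      1 (Pi.single (i : ℕ) (-1)) := HP.ofD (.eps ⟨rfl, Or.inr (Or.inl ⟨rfl, rfl, rfl⟩)⟩)
    have := a1.mul (read tt ww i _ h2)
    rwa [one_mul, add_zero, FreeGroup.mk_toWord] at this
  induction k with
  | zero => simpa using HP.ofD (.refl _)
  | succ n ih => simpa only [zpow_add_one, Pi.single_add] using ih.mul hp
  | pred n ih => 
    have := ih.mul hm
    rwa [← zpow_sub_one, ← Pi.single_add, ← sub_eq_add_neg] at this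

theorem complete (y : ℕ → ℤ) (h1 : ∀ i ≤ l, (tt i).toWord.length ≤ B)
    (h2 : ∀ i ≤ l, (tt i)⁻¹.toWord.length ≤ B) (h3 : ∀ i ≤ l, (ww i).toWord.length ≤ B) :
    ∀ (n : ℕ) (hn : n < l + 1),
    HP LetterMove (Ep tt ww) ((0, ⟨(ww 0).toWord, h3 0 (Nat.zero_le _)⟩) : St α l B)
      (⟨n, hn⟩, ⟨[], Nat.zero_le _⟩)
      (PP tt ww y n * tt n ^ y n) (fun j => if j ≤ n then y j else 0)
  | 0, hn => by
    have a := (read tt ww (0 : Fin (l + 1)) _ (h3 0 (Nat.zero_le _))).mul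
      (loop tt ww 0 (h1 0 (Nat.zero_le _)) (h2 0 (Nat.zero_le _)) (y 0))
    rw [FreeGroup.mk_toWord, zero_add] at a
    suffices e : (fun j => if j ≤ 0 then y j else 0) = Pi.single (((0 : Fin (l + 1)) : ℕ)) (y 0) by
      rw [e]; exact a
    funext j
    rcases Nat.eq_zero_or_pos j with rfl | hj
    · simp
    · simp [hj.ne']
  | n + 1, hn => by
    have ih := complete y h1 h2 h3 n (by omega)
    have b : HP LetterMove (Ep tt ww) ((⟨n, by omega⟩, ⟨[], Nat.zero_le _⟩) : St α l B)
      (⟨n + 1, hn⟩, ⟨(ww (n + 1)).toWord, h3 _ (by omega)⟩) 1 0 :=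
      HP.ofD (.eps ⟨rfl, Or.inr (Or.inr ⟨rfl, rfl, rfl⟩)⟩)
    have c := ((ih.mul b).mul (read tt ww ⟨n + 1, hn⟩ _ (h3 (n + 1) (by omega)))).mul
      (loop tt ww ⟨n + 1, hn⟩ (h1 _ (by simp; omega)) (h2 _ (by simp; omega)) (y (n + 1)))
    rw [FreeGroup.mk_toWord, mul_one, add_zero, add_zero] at c
    suffices e : (fun j => if j ≤ n + 1 then y j else 0) =
        (fun j => if j ≤ n then y j else 0) + Pi.single (n + 1) (y (n + 1)) by
      rw [e]; exact c
    funext j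
    rcases lt_trichotomy j (n + 1) with hj | rfl | hj
    · simp [hj.ne, hj.le, Nat.lt_succ_iff.1 hj]
    · simp
    · simp [hj.ne', hj.not_ge]; omega

end Concrete

theorem semilinear_main (g l : ℕ)
    (w : Fin (l + 1) → FreeGroup (Fin g)) (t : Fin l → FreeGroup (Fin g)) :
    IsSemilinearSet {k : Fin l → ℤ |
      w 0 * (List.ofFn (fun i : Fin l => t i ^ k i * w i.succ)).prod = 1} := by
  let tt : ℕ → FreeGroup (Fin g) := fun n => if h : n < l then t ⟨n, h⟩ else 1
  let ww : ℕ → FreeGroup (Fin g) := fun n => if h : n < l + 1 then w ⟨n, h⟩ else 1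
  have htl : tt l = 1 := by simp [tt]
  have hPP : ∀ y : ℕ → ℤ, PP tt ww y l * tt l ^ y l =
      w 0 * (List.ofFn (fun i : Fin l => t i ^ y i * w i.succ)).prod := by
    intro y
    rw [PP_eq, htl, one_zpow, mul_one]
    congr 3
    funext i
    simp [tt, ww]
    rfl
  let B : ℕ := ∑ i ∈ Finset.range (l + 1),
    ((tt i).toWord.length + (tt i)⁻¹.toWord.length + (ww i).toWord.length)
  have hB : ∀ i ≤ l,
      (tt i).toWord.length + (tt i)⁻¹.toWord.length + (ww i).toWord.length ≤ B := fun i hi =>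
    Finset.single_le_sum (f := fun i => (tt i).toWord.length + (tt i)⁻¹.toWord.length +
      (ww i).toWord.length) (fun _ _ => Nat.zero_le _) (Finset.mem_range.2 (by omega))
  have h1 : ∀ i ≤ l, (tt i).toWord.length ≤ B := fun i hi => by have := hB i hi; omega
  have h2 : ∀ i ≤ l, (tt i)⁻¹.toWord.length ≤ B := fun i hi => by have := hB i hi; omega
  have h3 : ∀ i ≤ l, (ww i).toWord.length ≤ B := fun i hi => by have := hB i hi; omega
  have : Finite {u : List (Fin g × Bool) // u.length ≤ B} :=
    (List.finite_length_le (Fin g × Bool) B).to_subtype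
  have key := D_semilinear (LetterMove (α := Fin g) (l := l) (B := B)) (Ep tt ww) (Ep_semilinear tt ww)
    (0, ⟨(ww 0).toWord, h3 0 (Nat.zero_le _)⟩) (⟨l, Nat.lt_succ_self l⟩, ⟨[], Nat.zero_le _⟩)
  have key2 := key.image (LinearMap.funLeft ℤ ℤ (fun i : Fin l => (i : ℕ)))
  convert key2 using 1
  ext k
  constructor
  · intro hk
    let y : ℕ → ℤ := fun n => if h : n < l then k ⟨n, h⟩ else 0
    have hy : ∀ i : Fin l, y i = k i := fun i => by simp [y]
    have c := complete tt ww y h1 h2 h3 l (Nat.lt_succ_self l)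
    rw [hPP] at c
    simp only [hy] at c
    rw [mem_ofPred_eq] at hk
    rw [hk] at c
    refine ⟨_, c.toD, ?_⟩
    funext i
    simp [LinearMap.funLeft, hy, i.2.le]
  · rintro ⟨v, hv, rfl⟩
    have := (sound tt ww hv 0 1 ⟨fun _ _ => rfl, by
      simp [FreeGroup.mk_toWord, PP]⟩).2
    simp only [zero_add] at this
    rw [hPP] at this
    exact this.symm

theorem semilinear_to_matrix (l : ℕ) (A : Set (Fin l → ℤ)) (hA : IsSemilinearSet A) :
    ∃ (N : ℕ) (d : Fin N → ℕ) (z : Fin N → (Fin l → ℤ))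
      (M : (j : Fin N) → Matrix (Fin l) (Fin (d j)) ℤ),
      A = ⋃ j : Fin N,
          {x : Fin l → ℤ |
            ∃ v : Fin (d j) → ℤ, (∀ i, 0 ≤ v i) ∧ x = z j + (M j).mulVec v} := by
  have lin : ∀ s : Set (Fin l → ℤ), IsLinearSet s → ∃ (d : ℕ) (z : Fin l → ℤ)
      (M : Matrix (Fin l) (Fin d) ℤ),
      s = {x | ∃ v : Fin d → ℤ, (∀ i, 0 ≤ v i) ∧ x = z + M.mulVec v} := by
    rintro s ⟨a, T, hT, rfl⟩
    obtain ⟨d, f, -, rfl⟩ := hT.fin_param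
    refine ⟨d, a, Matrix.of fun i j => f j i, ?_⟩
    have hmul : ∀ v : Fin d → ℤ, (Matrix.of fun i j => f j i).mulVec v = ∑ j, v j • f j := by
      intro v
      funext i
      simp [Matrix.mulVec, dotProduct, mul_comm]
    ext x
    rw [mem_vadd_set]
    simp only [hmul, mem_ofPred_eq, vadd_eq_add]
    constructor
    · rintro ⟨y, hy, rfl⟩
      suffices ∃ v : Fin d → ℤ, (∀ i, 0 ≤ v i) ∧ y = ∑ j, v j • f j by
        obtain ⟨v, h, rfl⟩ := this
        exact ⟨v, h, rfl⟩
      induction hy using AddSubmonoid.closure_induction with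
      | mem y hy =>
        obtain ⟨j, rfl⟩ := hy
        refine ⟨Pi.single j 1, fun i => ?_, ?_⟩
        · by_cases h : i = j
          · subst h; simp
          · simp [h]
        · simp [Pi.single_apply]
      | zero => exact ⟨0, fun _ => le_rfl, by simp⟩
      | add x y _ _ ih1 ih2 =>
        obtain ⟨v, h, rfl⟩ := ih1
        obtain ⟨v', h', rfl⟩ := ih2
        exact ⟨v + v', fun i => add_nonneg (h i) (h' i), by
          simp [add_smul, Finset.sum_add_distrib]⟩
    · rintro ⟨v, hv, rfl⟩
      refine ⟨_, ?_, rfl⟩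
      refine sum_mem fun j _ => ?_
      obtain ⟨n, hn⟩ := Int.eq_ofNat_of_zero_le (hv j)
      rw [hn, natCast_zsmul]
      exact nsmul_mem (AddSubmonoid.subset_closure (mem_range_self j)) n
  obtain ⟨S, hS, hlin, rfl⟩ := hA
  obtain ⟨N, s, -, rfl⟩ := hS.fin_param
  choose d z M h using fun j : Fin N => lin (s j) (hlin _ (mem_range_self j))
  refine ⟨N, d, z, M, ?_⟩
  rw [sUnion_range]
  exact iUnion_congr h

end ExpEq

/-- Let `g ≥ 1`, `l ≥ 1`, and let `w₀, …, w_l` and `t₁, …, t_l` be elements of the free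
group on `g` generators.  The set
`𝒜 = { k ∈ ℤ^l : w₀ · t₁^{k₁} · w₁ ⋯ t_l^{k_l} · w_l = 1 }`
is a finite union of affine images of nonnegative orthants. -/
theorem exponential_equation_in_free_group
    (g l : ℕ) (hg : 1 ≤ g) (hl : 1 ≤ l)
    (w : Fin (l + 1) → FreeGroup (Fin g)) (t : Fin l → FreeGroup (Fin g)) :
    ∃ (N : ℕ) (d : Fin N → ℕ) (z : Fin N → (Fin l → ℤ))
      (M : (j : Fin N) → Matrix (Fin l) (Fin (d j)) ℤ),
      {k : Fin l → ℤ |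
          w 0 * (List.ofFn (fun i : Fin l => t i ^ k i * w i.succ)).prod = 1} =
        ⋃ j : Fin N,
          {x : Fin l → ℤ |
            ∃ v : Fin (d j) → ℤ, (∀ i, 0 ≤ v i) ∧ x = z j + (M j).mulVec v} := by
  exact ExpEq.semilinear_to_matrix l _ (ExpEq.semilinear_main g l w t)
end

section
/- Let g ≥ 1 and l ≥ 1, and let w₀, w₁, …, w_l and t₁, …, t_l be elements of the free group F_g. Consider the set 𝒜⁺ = { (k₁,…,k_l) ∈ ℤ_{≥0}^l : w₀ · t₁^{k₁} · w₁ · t₂^{k₂} · w₂ ⋯ t_l^{k_l} · w_l = 1 in F_g }. Then 𝒜⁺ is a finite union of affine images of nonnegative orthants: there exist N ∈ ℕ and, for each j ∈ {1,…,N}, a vector z_j ∈ ℤ^l, a natural number d_j, and an l×d_j integer matrix M_j, such that 𝒜⁺ = ⋃_{j=1}^{N} { z_j + M_j·v : v ∈ ℤ_{≥0}^{d_j} }. -/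
open FreeGroup

namespace ExpEq

/-- values of the prefixes of a word -/
def Pre {α : Type*} (W : List (α × Bool)) : Set (FreeGroup α) :=
  {p | ∃ q, q <+: W ∧ p = FreeGroup.mk q}

/-- points of the geodesic from `1` to `g` -/
def Seg {α : Type*} [DecidableEq α] (g : FreeGroup α) : Set (FreeGroup α) := Pre g.toWord

section
variable {α : Type*}

lemma pre_finite (W : List (α × Bool)) : (Pre W).Finite := by
  have : Pre W = FreeGroup.mk '' {q | q ∈ W.inits} := by
    ext p; simp [Pre, List.mem_inits, eq_comm]
  rw [this]
  exact (List.finite_toSet _).image _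

lemma prefix_append_cases {β : Type*} {q A B : List β} (h : q <+: A ++ B) :
    q <+: A ∨ ∃ r, r <+: B ∧ q = A ++ r := by
  obtain ⟨s, hs⟩ := h
  rcases List.append_eq_append_iff.1 hs with ⟨a, h1, h2⟩ | ⟨a, h1, h2⟩
  · left; exact ⟨a, h1.symm⟩
  · right; exact ⟨a, ⟨s, h2.symm⟩, h1⟩

lemma pre_append (A B : List (α × Bool)) {p : FreeGroup α} (hp : p ∈ Pre (A ++ B)) :
    p ∈ Pre A ∨ ∃ q ∈ Pre B, p = FreeGroup.mk A * q := by
  obtain ⟨q, hq, rfl⟩ := hp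
  rcases prefix_append_cases hq with h | ⟨r, hr, rfl⟩
  · left; exact ⟨q, h, rfl⟩
  · right; exact ⟨_, ⟨r, hr, rfl⟩, by rw [FreeGroup.mul_mk]⟩

lemma pre_step {A B : List (α × Bool)} (h : Red.Step A B) : Pre B ⊆ Pre A := by
  intro p hp
  cases h with
  | @not L₁ L₂ x b =>
    obtain ⟨q, hq, rfl⟩ := hp
    rcases prefix_append_cases hq with h | ⟨r, hr, rfl⟩
    · exact ⟨q, h.trans (List.prefix_append _ _), rfl⟩
    · refine ⟨L₁ ++ (x, b) :: (x, !b) :: r, ?_, ?_⟩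
      · obtain ⟨s, rfl⟩ := hr
        exact ⟨s, by simp⟩
      · symm
        exact Quot.sound Red.Step.not

lemma pre_red {A B : List (α × Bool)} (h : Red A B) : Pre B ⊆ Pre A := by
  induction h with
  | refl => exact subset_rfl
  | tail _ h ih => exact (pre_step h).trans ih

variable [DecidableEq α]

lemma seg_finite (g : FreeGroup α) : (Seg g).Finite := pre_finite _

lemma seg_mul (a b : FreeGroup α) {p : FreeGroup α} (hp : p ∈ Seg (a * b)) :
    p ∈ Seg a ∨ ∃ q ∈ Seg b, p = a * q := by
  unfold Seg at hp
  rw [toWord_mul] at hp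
  have := pre_append _ _ (pre_red reduce.red hp)
  rwa [mk_toWord] at this

lemma seg_one {p : FreeGroup α} (hp : p ∈ Seg (1 : FreeGroup α)) : p = 1 := by
  obtain ⟨q, hq, rfl⟩ := hp
  simp at hq
  subst hq; rfl

lemma one_mem_seg (a : FreeGroup α) : 1 ∈ Seg a := ⟨[], by simp, rfl⟩

lemma seg_pow (x : FreeGroup α) (n : ℕ) {p : FreeGroup α} (hp : p ∈ Seg (x ^ n)) :
    ∃ b ≤ n, ∃ d ∈ Seg x, p = x ^ b * d := by
  induction n generalizing p with
  | zero =>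
    rw [pow_zero] at hp
    exact ⟨0, le_rfl, 1, one_mem_seg _, by simp [seg_one hp]⟩
  | succ n ih =>
    rw [pow_succ] at hp
    rcases seg_mul _ _ hp with h | ⟨q, hq, rfl⟩
    · obtain ⟨b, hb, d, hd, h⟩ := ih h
      exact ⟨b, by omega, d, hd, h⟩
    · exact ⟨n, by omega, q, hq, rfl⟩

lemma pow_near_seg (x : FreeGroup α) : ∃ C : Set (FreeGroup α), C.Finite ∧
    ∀ n a : ℕ, a ≤ n → ∃ p ∈ Seg (x ^ n), ∃ c ∈ C, x ^ a = p * c := by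
  set c := FreeGroup.reduceCyclically.conjugator x.toWord with hc
  set r := FreeGroup.reduceCyclically x.toWord with hr
  have hx : x = FreeGroup.mk c * FreeGroup.mk r * (FreeGroup.mk c)⁻¹ := by
    rw [FreeGroup.inv_mk, FreeGroup.mul_mk, FreeGroup.mul_mk,
      FreeGroup.reduceCyclically.conj_conjugator_reduceCyclically, mk_toWord]
  refine ⟨{1, (FreeGroup.mk c)⁻¹}, by simp, fun n a han => ?_⟩
  by_cases hn : n = 0
  · subst hn
    obtain rfl : a = 0 := by omega
    exact ⟨1, one_mem_seg _, 1, by simp, by simp⟩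
  refine ⟨FreeGroup.mk (c ++ (List.replicate a r).flatten), ⟨_, ?_, rfl⟩, _, Or.inr rfl, ?_⟩
  · rw [toWord_pow, FreeGroup.reduceCyclically.reduce_flatten_replicate isReduced_toWord, if_neg hn]
    obtain ⟨m, rfl⟩ := Nat.exists_eq_add_of_le han
    rw [List.replicate_add, List.flatten_append, ← hc, ← hr]
    exact ⟨(List.replicate m r).flatten ++ invRev c, by simp⟩
  · rw [← FreeGroup.mul_mk, ← FreeGroup.pow_mk, ← conj_pow, ← hx]
end

section
variable {G : Type*} [Group G]

/-- value of an exponential word -/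
def ev {ι : Type} (L : List (G × G × ι)) (k : ι → ℕ) : G :=
  (L.map fun s => s.1 ^ k s.2.2 * s.2.1).prod

lemma ev_nil {ι : Type} (k : ι → ℕ) : ev ([] : List (G × G × ι)) k = 1 := rfl
lemma ev_cons {ι : Type} (s : G × G × ι) (L : List (G × G × ι)) (k : ι → ℕ) :
    ev (s :: L) k = s.1 ^ k s.2.2 * s.2.1 * ev L k := by simp [ev]
lemma ev_append {ι : Type} (L L' : List (G × G × ι)) (k : ι → ℕ) :
    ev (L ++ L') k = ev L k * ev L' k := by simp [ev]

lemma bigon {ι : Type} [Finite ι] (x y g : G) (i j : ι) :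
    IsSemilinearSet {k : ι → ℕ | x ^ k i * y ^ k j = g} := by
  let H : AddSubgroup (ℤ × ℤ) :=
    { carrier := {v | x ^ v.1 * y ^ v.2 = 1}
      zero_mem' := by simp
      add_mem' := by
        rintro ⟨a, b⟩ ⟨c, d⟩ h1 h2
        simp only [Set.mem_ofPred_eq, Prod.mk_add_mk] at *
        rw [zpow_add, add_comm b d, zpow_add]
        calc x ^ a * x ^ c * (y ^ d * y ^ b) = x ^ a * (x ^ c * y ^ d) * y ^ b := by group
          _ = 1 := by rw [h2]; simpa using h1
      neg_mem' := by
        rintro ⟨a, b⟩ h1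
        simp only [Set.mem_ofPred_eq, Prod.neg_mk] at *
        rw [zpow_neg, zpow_neg, ← mul_inv_rev, inv_eq_one]
        exact mul_eq_one_comm.1 h1 }
  have hH : H.toAddSubmonoid.FG := by
    rw [← AddSubgroup.fg_iff_addSubmonoid_fg, ← AddSubgroup.toIntSubmodule_toAddSubgroup H,
      ← Submodule.fg_iff_addSubgroup_fg]
    exact IsNoetherian.noetherian _
  have hT : IsSemilinearSet {v : ℤ × ℤ | x ^ v.1 * y ^ v.2 = g} := by
    by_cases hne : ∃ v : ℤ × ℤ, x ^ v.1 * y ^ v.2 = g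
    · obtain ⟨⟨a, b⟩, h⟩ := hne
      convert (IsSemilinearSet.of_fg hH).vadd (a, b)
      ext ⟨c, d⟩
      rw [Set.mem_vadd_set_iff_neg_vadd_mem]
      change _ ↔ x ^ (-a + c) * y ^ (-b + d) = 1
      simp only [Set.mem_ofPred_eq] at *
      rw [← h, add_comm (-b), zpow_add, zpow_add, zpow_neg, zpow_neg]
      constructor
      · intro h'
        calc (x ^ a)⁻¹ * x ^ c * (y ^ d * (y ^ b)⁻¹)
            = (x ^ a)⁻¹ * (x ^ c * y ^ d) * (y ^ b)⁻¹ := by simp only [mul_assoc]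
          _ = 1 := by rw [h']; simp [mul_assoc]
      · intro h'
        calc x ^ c * y ^ d
            = x ^ a * ((x ^ a)⁻¹ * x ^ c * (y ^ d * (y ^ b)⁻¹)) * y ^ b := by simp [mul_assoc]
          _ = x ^ a * y ^ b := by rw [h', mul_one]
    · convert IsSemilinearSet.empty
      ext v
      simp only [Set.mem_ofPred_eq, Set.mem_empty_iff_false, iff_false]
      exact fun h => hne ⟨v, h⟩
  let f : (ι → ℕ) →+ ℤ × ℤ :=
    { toFun := fun k => ((k i : ℤ), (k j : ℤ))
      map_zero' := by simp
      map_add' := by intros; simp }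
  convert hT.preimage f
  ext k
  simp [f]


lemma bigon' {ι : Type} [Finite ι] (x w y w' g : G) (i j : ι) :
    IsSemilinearSet {k : ι → ℕ | x ^ k i * w * y ^ k j * w' = g} := by
  convert bigon x (w * y * w⁻¹) (g * w'⁻¹ * w⁻¹) i j using 1
  ext k
  simp only [Set.mem_ofPred_eq]
  rw [conj_pow, eq_mul_inv_iff_mul_eq, eq_mul_inv_iff_mul_eq]
  simp [mul_assoc]

lemma ev_map {ι κ : Type} (φ : ι → κ) (L : List (G × G × ι)) (k : κ → ℕ) :
    ev (L.map fun s => (s.1, s.2.1, φ s.2.2)) k = ev L (k ∘ φ) := by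
  simp [ev, Function.comp_def]

lemma splits_finite {β : Type*} (L : List β) :
    {τ : List β × β × List β | L = τ.1 ++ τ.2.1 :: τ.2.2}.Finite := by
  refine Set.Finite.of_injOn (f := fun τ => τ.1.length) (t := Set.Iio L.length) ?_ ?_
    (Set.finite_Iio _)
  · rintro ⟨P, s, Q⟩ h
    simp only [Set.mem_ofPred_eq] at h
    simp [h]
  · rintro ⟨P, s, Q⟩ h ⟨P', s', Q'⟩ h' hl
    simp only [Set.mem_ofPred_eq] at h h' hl
    obtain ⟨h1, h2⟩ := List.append_inj (h.symm.trans h') hl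
    simp at h2
    simp [h1, h2]

/-- the semilinear step: the pieces of a decomposed polygon define a semilinear set -/
lemma piece {ι : Type} [Finite ι] (x w₁ y w₂ d d' g : G) (i₁ i₂ : ι) (e : ℕ)
    (P Q : List (G × G × ι)) (s : G × G × ι)
    (h2 : ∀ L : List (G × G × (ι ⊕ Fin 6)), L.length = P.length + 2 → ∀ g,
      IsSemilinearSet {k | ev L k = g})
    (h3 : ∀ L : List (G × G × (ι ⊕ Fin 6)), L.length = Q.length + 2 → ∀ g,
      IsSemilinearSet {k | ev L k = g}) :
    IsSemilinearSet {k : ι → ℕ | ∃ v : Fin 6 → ℕ,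
      k i₁ = v 0 + e + v 2 ∧ k i₂ = v 1 + v 3 ∧ k s.2.2 = v 4 + v 5 ∧
      x ^ v 0 * w₁ * y ^ v 1 * d = 1 ∧
      y ^ v 3 * w₂ * ev P k * s.1 ^ v 4 * d' = d * (x ^ e)⁻¹ ∧
      x ^ v 2 * d'⁻¹ * (s.1 ^ v 5 * s.2.1 * ev Q k) = g} := by
  apply IsSemilinearSet.proj'
  let E : (ι ⊕ Fin 6) → ((ι ⊕ Fin 6 → ℕ) →+ ℕ) := fun z => Pi.evalAddMonoidHom _ z
  have l1 : IsSemilinearSet {z : ι ⊕ Fin 6 → ℕ |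
      0 + E (.inl i₁) z = e + (E (.inr 0) + E (.inr 2)) z} := isSemilinearSet_setOfPred_eq _ _ _ _
  have l2 : IsSemilinearSet {z : ι ⊕ Fin 6 → ℕ |
      0 + E (.inl i₂) z = 0 + (E (.inr 1) + E (.inr 3)) z} := isSemilinearSet_setOfPred_eq _ _ _ _
  have l3 : IsSemilinearSet {z : ι ⊕ Fin 6 → ℕ |
      0 + E (.inl s.2.2) z = 0 + (E (.inr 4) + E (.inr 5)) z} :=
    isSemilinearSet_setOfPred_eq _ _ _ _
  have l4 := bigon' (ι := ι ⊕ Fin 6) x w₁ y d 1 (.inr 0) (.inr 1)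
  have l5 := h2 ((y, w₂, .inr 3) :: (P.map fun s => (s.1, s.2.1, .inl s.2.2)) ++
    [(s.1, d', .inr 4)]) (by simp) (d * (x ^ e)⁻¹)
  have l6 := h3 ((x, d'⁻¹, .inr 2) :: (s.1, s.2.1, .inr 5) ::
    (Q.map fun s => (s.1, s.2.1, .inl s.2.2))) (by simp) g
  convert l1.inter (l2.inter (l3.inter (l4.inter (l5.inter l6)))) using 1
  ext z
  simp only [Set.mem_inter_iff, Set.mem_ofPred_eq, ev_cons, ev_append, ev_map, ev_nil,
    Function.comp_apply, E, AddMonoidHom.add_apply, Pi.evalAddMonoidHom_apply, zero_add, mul_one]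
  refine and_congr ?_ (and_congr Iff.rfl (and_congr Iff.rfl (and_congr Iff.rfl
    (and_congr ?_ Iff.rfl))))
  · omega
  · simp only [mul_assoc]

end

section
variable {α : Type*} [DecidableEq α] {ι : Type}

lemma cover (L : List (FreeGroup α × FreeGroup α × ι)) (g : FreeGroup α) :
    ∃ D : Set (FreeGroup α), D.Finite ∧ ∀ k : ι → ℕ, ∀ p ∈ Seg (ev L k * g),
      p ∈ D ∨ ∃ P s Q, L = P ++ s :: Q ∧ ∃ b ≤ k s.2.2, ∃ d ∈ D, p = ev P k * s.1 ^ b * d := by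
  induction L with
  | nil =>
    refine ⟨Seg g, seg_finite g, fun k p hp => Or.inl ?_⟩
    simpa [ev_nil] using hp
  | cons s L ih =>
    obtain ⟨D, hD, h⟩ := ih
    refine ⟨D ∪ Seg s.1 ∪ Seg s.2.1 ∪ (fun d => s.2.1 * d) '' D,
      ((hD.union (seg_finite _)).union (seg_finite _)).union (hD.image _), fun k p hp => Or.inr ?_⟩
    rw [ev_cons, mul_assoc, mul_assoc] at hp
    rcases seg_mul _ _ hp with h1 | ⟨q, hq, rfl⟩
    · obtain ⟨b, hb, d, hd, rfl⟩ := seg_pow _ _ h1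
      exact ⟨[], s, L, rfl, b, hb, d, by simp [hd], by simp [ev_nil]⟩
    · rcases seg_mul _ _ hq with h1 | ⟨r, hr, rfl⟩
      · exact ⟨[], s, L, rfl, _, le_rfl, q, by simp [h1], by simp [ev_nil]⟩
      · rcases h k r hr with h1 | ⟨P, s', Q, rfl, b, hb, d, hd, rfl⟩
        · exact ⟨[], s, L, rfl, _, le_rfl, s.2.1 * r, Or.inr ⟨r, h1, rfl⟩, by simp [ev_nil]⟩
        · exact ⟨s :: P, s', Q, rfl, b, hb, d, by simp [hd], by simp [ev_cons, mul_assoc]⟩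

lemma decomp (x w₁ y w₂ g : FreeGroup α) (i₁ i₂ : ι)
    (L : List (FreeGroup α × FreeGroup α × ι)) (hL : L ≠ []) :
    ∃ D : Set (FreeGroup α), D.Finite ∧ ∀ k : ι → ℕ,
      ev ((x, w₁, i₁) :: (y, w₂, i₂) :: L) k = g ↔
      ∃ τ ∈ {τ : List (FreeGroup α × FreeGroup α × ι) × _ × List _ | L = τ.1 ++ τ.2.1 :: τ.2.2},
      ∃ d ∈ D, ∃ d' ∈ D, ∃ e ∈ ({0, 1} : Set ℕ), ∃ v : Fin 6 → ℕ,
      k i₁ = v 0 + e + v 2 ∧ k i₂ = v 1 + v 3 ∧ k τ.2.1.2.2 = v 4 + v 5 ∧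
      x ^ v 0 * w₁ * y ^ v 1 * d = 1 ∧
      y ^ v 3 * w₂ * ev τ.1 k * τ.2.1.1 ^ v 4 * d' = d * (x ^ e)⁻¹ ∧
      x ^ v 2 * d'⁻¹ * (τ.2.1.1 ^ v 5 * τ.2.1.2.1 * ev τ.2.2 k) = g := by
  obtain ⟨D₀, hD₀, h₀⟩ := cover ((y, w₂, i₂) :: L) g⁻¹
  obtain ⟨C, hC, hnear⟩ := pow_near_seg x⁻¹
  obtain ⟨P₀, s₀, hP₀⟩ : ∃ P s, L = P ++ [s] :=
    ⟨_, _, (List.dropLast_append_getLast hL).symm⟩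
  let D₁ : Set (FreeGroup α) := D₀ ∪ (fun q => w₁⁻¹ * q) '' Seg w₁
  let D : Set (FreeGroup α) := Set.image2 (fun a b => a * b) D₁ C ∪ {w₁⁻¹, s₀.2.1 * g⁻¹}
  have hD₁ : D₁.Finite := hD₀.union ((seg_finite _).image _)
  refine ⟨D, (Set.Finite.image2 _ hD₁ hC).union (by simp), fun k => ⟨fun hk => ?_, ?_⟩⟩
  · let A : ℕ → Prop := fun a => ∃ b ≤ k i₂, ∃ d ∈ D, (x ^ a)⁻¹ = w₁ * y ^ b * d
    let B : ℕ → Prop := fun a => ∃ P s Q, L = P ++ s :: Q ∧ ∃ b ≤ k s.2.2, ∃ d ∈ D,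
      (x ^ a)⁻¹ = w₁ * y ^ k i₂ * w₂ * ev P k * s.1 ^ b * d
    have hR : (x⁻¹) ^ k i₁ = w₁ * (ev ((y, w₂, i₂) :: L) k * g⁻¹) := by
      rw [ev_cons] at hk
      rw [← hk]
      simp [mul_assoc]
    have hAB : ∀ a ≤ k i₁, A a ∨ B a := by
      intro a ha
      obtain ⟨p, hp, c, hc, hpc⟩ := hnear (k i₁) a ha
      rw [inv_pow] at hpc
      rw [hR] at hp
      have hD' : ∀ d ∈ D₁, d * c ∈ D := fun d hd => Or.inl ⟨d, hd, c, hc, rfl⟩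
      rcases seg_mul _ _ hp with h1 | ⟨q, hq, rfl⟩
      · left
        refine ⟨0, by simp, _, hD' (w₁⁻¹ * p) (Or.inr ⟨p, h1, rfl⟩), ?_⟩
        rw [hpc]; simp [mul_assoc]
      · rcases h₀ k q hq with h1 | ⟨P, s, Q, h1, b, hb, d, hd, rfl⟩
        · left
          refine ⟨0, by simp, _, hD' q (Or.inl h1), ?_⟩
          rw [hpc]; simp [mul_assoc]
        · cases P with
          | nil =>
            simp only [List.nil_append, List.cons.injEq] at h1
            obtain ⟨rfl, rfl⟩ := h1
            left
            refine ⟨b, hb, _, hD' d (Or.inl hd), ?_⟩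
            rw [hpc]; simp [mul_assoc, ev_nil]
          | cons s' P =>
            simp only [List.cons_append, List.cons.injEq] at h1
            obtain ⟨rfl, h1⟩ := h1
            right
            refine ⟨P, s, Q, h1, b, hb, _, hD' d (Or.inl hd), ?_⟩
            rw [hpc]; simp [mul_assoc, ev_cons]
    have hA0 : A 0 := ⟨0, by simp, w₁⁻¹, by simp [D], by simp⟩
    have hBk : B (k i₁) := by
      refine ⟨P₀, s₀, [], hP₀, _, le_rfl, s₀.2.1 * g⁻¹, by simp [D], ?_⟩
      rw [← inv_pow, hR, hP₀]
      simp [ev_cons, ev_append, ev_nil, mul_assoc]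
    obtain ⟨a, e, he, hae, ⟨b, hb, d, hd, h1⟩, ⟨P, s, Q, hs, b', hb', d', hd', h2⟩⟩ :
        ∃ a e, e ∈ ({0, 1} : Set ℕ) ∧ a + e ≤ k i₁ ∧ A a ∧ B (a + e) := by
      by_contra hcon
      push Not at hcon
      have : ∀ a ≤ k i₁, A a := by
        intro a
        induction a with
        | zero => exact fun _ => hA0
        | succ a ih =>
          intro ha
          exact (hAB _ ha).resolve_right (hcon a 1 (by simp) ha (ih (by omega)))
      exact hcon (k i₁) 0 (by simp) le_rfl (this _ le_rfl) hBk
    obtain ⟨a', ha'⟩ := Nat.exists_eq_add_of_le hae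
    obtain ⟨c, hc⟩ := Nat.exists_eq_add_of_le hb
    obtain ⟨c', hc'⟩ := Nat.exists_eq_add_of_le hb'
    have e1 : x ^ a * w₁ * y ^ b * d = 1 := by
      rw [inv_eq_iff_mul_eq_one] at h1
      rw [← h1]; simp only [mul_assoc]
    refine ⟨(P, s, Q), hs, d, hd, d', hd', e, he, ![a, b, a', c, b', c'], ?_⟩
    refine ⟨ha', hc, hc', e1, ?_, ?_⟩
    · change y ^ c * w₂ * ev P k * s.1 ^ b' * d' = d * (x ^ e)⁻¹
      have e2 : (x ^ e)⁻¹ = x ^ a * (x ^ (a + e))⁻¹ := by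
        rw [add_comm a e, pow_add]; simp
      have e3 : d * x ^ a * w₁ * y ^ b = 1 := by
        have := mul_eq_one_comm.1 e1
        simpa [mul_assoc] using this
      rw [e2, h2, hc, pow_add]
      calc _ = 1 * (y ^ c * w₂ * ev P k * s.1 ^ b' * d') := by simp
        _ = _ := by rw [← e3]; simp only [mul_assoc]
    · change x ^ a' * d'⁻¹ * (s.1 ^ c' * s.2.1 * ev Q k) = g
      rw [← hk, ev_cons, ev_cons, hs, ev_append, ev_cons]
      simp only
      rw [ha', hc', add_comm (a + e), pow_add x, pow_add s.1]
      have e4 : d'⁻¹ = x ^ (a + e) * (w₁ * y ^ k i₂ * w₂ * ev P k * s.1 ^ b') := by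
        rw [eq_comm, ← mul_eq_one_iff_eq_inv, mul_assoc, ← h2, mul_inv_cancel]
      rw [e4]
      simp only [mul_assoc]
  · rintro ⟨⟨P, s, Q⟩, hs, d, -, d', -, e, -, v, h1, h2, h3, h4, h5, h6⟩
    simp only [Set.mem_ofPred_eq] at hs h3 h5 h6
    rw [ev_cons, ev_cons, hs, ev_append, ev_cons]
    simp only
    rw [← h6, h1, h2, h3, add_comm (v 0 + e), add_comm (v 0), pow_add, pow_add, pow_add, pow_add]
    have e1 : x ^ v 0 * w₁ * y ^ v 1 = d⁻¹ := mul_eq_one_iff_eq_inv.1 h4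
    have e2 : y ^ v 3 * w₂ * ev P k * s.1 ^ v 4 = d * (x ^ e)⁻¹ * d'⁻¹ := eq_mul_inv_of_mul_eq h5
    calc _ = x ^ v 2 * x ^ e * (x ^ v 0 * w₁ * y ^ v 1) *
          (y ^ v 3 * w₂ * ev P k * s.1 ^ v 4) * (s.1 ^ v 5 * s.2.1 * ev Q k) := by
          simp only [mul_assoc]
      _ = _ := by rw [e1, e2]; simp [mul_assoc]

theorem main (n : ℕ) : ∀ {ι : Type} [Finite ι] (L : List (FreeGroup α × FreeGroup α × ι)),
    L.length = n → ∀ g, IsSemilinearSet {k | ev L k = g} := by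
  induction n using Nat.strong_induction_on with
  | _ n ih =>
  intro ι _ L hn g
  match L, hn with
  | [], _ =>
    by_cases h : (1 : FreeGroup α) = g
    · convert IsSemilinearSet.univ (M := ι → ℕ)
      simp [ev_nil, h]
    · convert IsSemilinearSet.empty (M := ι → ℕ)
      simp [ev_nil, h]
  | [(x, w, i)], _ =>
    convert bigon' x w 1 1 g i i using 1
    simp [ev_cons, ev_nil]
  | [(x, w, i), (y, w', j)], _ =>
    convert bigon' x w y w' g i j using 1
    simp [ev_cons, ev_nil, mul_assoc]
  | (x, w₁, i₁) :: (y, w₂, i₂) :: s₀ :: L, hn =>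
    obtain ⟨D, hD, h⟩ := decomp x w₁ y w₂ g i₁ i₂ (s₀ :: L) (by simp)
    simp only [h]
    simp only [← exists_prop, Set.ofPred_exists]
    refine .biUnion (splits_finite _) fun τ hτ => .biUnion hD fun d _ => .biUnion hD fun d' _ =>
      .biUnion (by simp) fun e _ => ?_
    simp only [exists_prop, ← Set.ofPred_exists]
    have hlen := congrArg List.length hτ
    simp at hlen hn
    apply piece
    · intro L' hL' g'
      exact ih _ (by omega) L' hL' g'
    · intro L' hL' g'
      exact ih _ (by omega) L' hL' g'

end
end ExpEq

/-- Let `g ≥ 1`, `l ≥ 1`, and let `w₀, …, w_l` and `t₁, …, t_l` be elements of the free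
group on `g` generators.  The set
`𝒜⁺ = { k ∈ ℤ_{≥0}^l : w₀ · t₁^{k₁} · w₁ ⋯ t_l^{k_l} · w_l = 1 }`
is a finite union of affine images of nonnegative orthants. -/
theorem exponential_equation_in_free_group_nonneg
    (g l : ℕ) (hg : 1 ≤ g) (hl : 1 ≤ l)
    (w : Fin (l + 1) → FreeGroup (Fin g)) (t : Fin l → FreeGroup (Fin g)) :
    ∃ (N : ℕ) (d : Fin N → ℕ) (z : Fin N → (Fin l → ℤ))
      (M : (j : Fin N) → Matrix (Fin l) (Fin (d j)) ℤ),
      {k : Fin l → ℤ | (∀ i, 0 ≤ k i) ∧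
          w 0 * (List.ofFn (fun i : Fin l => t i ^ k i * w i.succ)).prod = 1} =
        ⋃ j : Fin N,
          {x : Fin l → ℤ |
            ∃ v : Fin (d j) → ℤ, (∀ i, 0 ≤ v i) ∧ x = z j + (M j).mulVec v} := by
  have h := ExpEq.main l (List.ofFn fun i : Fin l => (t i, w i.succ, i)) (by simp) (w 0)⁻¹
  let f : (Fin l → ℕ) →+ (Fin l → ℤ) :=
    { toFun := fun k i => (k i : ℤ)
      map_zero' := by ext; simp
      map_add' := by intros; ext; simp }
  have h' := h.image f
  have hS : {k : Fin l → ℤ | (∀ i, 0 ≤ k i) ∧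
          w 0 * (List.ofFn (fun i : Fin l => t i ^ k i * w i.succ)).prod = 1} =
      f '' {k | ExpEq.ev (List.ofFn fun i : Fin l => (t i, w i.succ, i)) k = (w 0)⁻¹} := by
    ext k
    simp only [Set.mem_ofPred_eq, Set.mem_image, ExpEq.ev, List.map_ofFn, Function.comp_def]
    constructor
    · rintro ⟨h0, h1⟩
      refine ⟨fun i => (k i).toNat, ?_, ?_⟩
      · rw [← eq_comm, inv_eq_iff_mul_eq_one, ← h1]
        congr 3
        ext i : 1
        rw [← zpow_natCast, Int.toNat_of_nonneg (h0 i)]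
      · ext i
        exact Int.toNat_of_nonneg (h0 i)
    · rintro ⟨m, hm, rfl⟩
      refine ⟨fun i => Int.natCast_nonneg _, ?_⟩
      rw [eq_comm, inv_eq_iff_mul_eq_one] at hm
      rw [← hm]
      congr 3
  rw [hS]
  obtain ⟨S, hS1, hS2⟩ := isSemilinearSet_iff.1 h'
  choose a n φ hφ using fun s : S => isLinearSet_iff_exists_fin_addMonoidHom.1 (hS1 s.1 s.2)
  let E := S.equivFin
  refine ⟨S.card, fun j => n (E.symm j), fun j => a (E.symm j),
    fun j => Matrix.of fun i c => φ (E.symm j) (Pi.single c 1) i, ?_⟩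
  have key : ∀ s : S, (s : Set (Fin l → ℤ)) = {x | ∃ v : Fin (n s) → ℤ, (∀ i, 0 ≤ v i) ∧
      x = a s + (Matrix.of fun i c => φ s (Pi.single c 1) i).mulVec v} := by
    intro s
    have hmul : ∀ u : Fin (n s) → ℕ,
        φ s u = (Matrix.of fun i c => φ s (Pi.single c 1) i).mulVec fun c => (u c : ℤ) := by
      intro u
      have hu : u = ∑ c, u c • (Pi.single c 1 : Fin (n s) → ℕ) := by
        ext c; simp [Finset.sum_apply, Pi.single_apply]
      conv_lhs => rw [hu]
      ext i
      simp only [map_sum, map_nsmul]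
      simp [Matrix.mulVec, dotProduct, Finset.sum_apply, mul_comm]
    conv_lhs => rw [hφ s]
    ext y
    simp only [Set.mem_vadd_set, Set.mem_range, Set.mem_ofPred_eq, vadd_eq_add]
    constructor
    · rintro ⟨_, ⟨u, rfl⟩, rfl⟩
      exact ⟨fun c => (u c : ℤ), fun i => Int.natCast_nonneg _, by rw [hmul]⟩
    · rintro ⟨v, hv, rfl⟩
      refine ⟨_, ⟨fun c => (v c).toNat, rfl⟩, ?_⟩
      rw [hmul]
      congr 2
      ext c
      exact Int.toNat_of_nonneg (hv c)
  rw [hS2, Set.sUnion_eq_iUnion]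
  refine (E.symm.surjective.iUnion_comp (fun s : S => (s : Set (Fin l → ℤ)))).symm.trans ?_
  exact Set.iUnion_congr fun j => key _
end

section
/- Let B be a band system of length 2n and let P ⊆ {0,1,…,2n} be a marking. Let (a₁,b₁) and (a₂,b₂) be bands of B with a₁ < a₂ < b₂ < b₁. Then at least one of the following holds: (i) for every integer i with 0 ≤ i ≤ a₂ − a₁ the pair (a₁+i, b₁−i) is a band of B, and no g ∈ P satisfies a₁ ≤ g < a₂ or b₂ ≤ g < b₁; (ii) some g ∈ P satisfies a₁ ≤ g < a₂ or b₂ ≤ g < b₁; (iii) there is a band (c, c+1) ∈ B with a₁ ≤ c ≤ a₂−1 or b₂ ≤ c ≤ b₁−1. -/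
/-- A band system on the positions `{1, …, m}`: a set of pairs `(a, b)` with
`1 ≤ a < b ≤ m`, such that every element of `{1, …, m}` is an endpoint of exactly
one pair, and no two pairs cross. -/
def IsBandSystem (m : ℕ) (B : Set (ℕ × ℕ)) : Prop :=
  (∀ p ∈ B, 1 ≤ p.1 ∧ p.1 < p.2 ∧ p.2 ≤ m) ∧
  (∀ c : ℕ, 1 ≤ c → c ≤ m → ∃! p : ℕ × ℕ, p ∈ B ∧ (p.1 = c ∨ p.2 = c)) ∧
  (∀ p ∈ B, ∀ q ∈ B, ¬(p.1 < q.1 ∧ q.1 < p.2 ∧ p.2 < q.2))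

lemma band_width_one {m : ℕ} {B : Set (ℕ × ℕ)}
    (hr : ∀ p q, (p, q) ∈ B → 1 ≤ p ∧ p < q ∧ q ≤ m)
    (hex : ∀ c, 1 ≤ c → c ≤ m → ∃ d, (c, d) ∈ B ∨ (d, c) ∈ B)
    (hx : ∀ p q r s, (p, q) ∈ B → (r, s) ∈ B → ¬ (p < r ∧ r < q ∧ q < s))
    (hu : ∀ p q r s, (p, q) ∈ B → (r, s) ∈ B → (p = r ∨ p = s ∨ q = r ∨ q = s) →
      p = r ∧ q = s) :
    ∀ k p q, q - p ≤ k → (p, q) ∈ B → ∃ c, p ≤ c ∧ c + 1 ≤ q ∧ (c, c + 1) ∈ B := by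
  intro k
  induction k with
  | zero => intro p q h hpq; have := hr p q hpq; omega
  | succ k ih =>
    intro p q h hpq
    have h1 := hr p q hpq
    by_cases hq : q = p + 1
    · subst hq; exact ⟨p, le_rfl, le_rfl, hpq⟩
    obtain ⟨d, hd | hd⟩ := hex (p + 1) (by omega) (by omega)
    · have h2 := hr _ _ hd
      have h3 := hx _ _ _ _ hpq hd
      have h4 := hu _ _ _ _ hpq hd
      obtain ⟨c, hc1, hc2, hc⟩ := ih (p + 1) d (by omega) hd
      exact ⟨c, by omega, by omega, hc⟩
    · have h2 := hr _ _ hd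
      have h3 := hx _ _ _ _ hd hpq
      have h4 := hu _ _ _ _ hpq hd
      omega

/-- Let `B` be a band system of length `2n`, and let `P ⊆ {0, 1, …, 2n}` be a marking
(an element `x ∈ P` represents the marked spot `x + 1/2`).  If `(a₁, b₁)` and
`(a₂, b₂)` are bands of `B` with `a₁ < a₂ < b₂ < b₁`, then at least one of the
following holds:
(i) `(a₁ + i, b₁ - i) ∈ B` for every `0 ≤ i ≤ a₂ - a₁`, and no marked spot lies
between `a₁` and `a₂` or between `b₂` and `b₁` (i.e. the two bands are bundled
together in the maximal bundle);
(ii) some marked spot lies between `a₁` and `a₂` or between `b₂` and `b₁`;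
(iii) there is a band `(c, c+1) ∈ B` with `a₁ ≤ c ≤ a₂ - 1` or `b₂ ≤ c ≤ b₁ - 1`. -/
theorem nested_bands_bundle_or_mark_or_width_one
    (n : ℕ) (B : Set (ℕ × ℕ)) (hB : IsBandSystem (2 * n) B)
    (P : Set ℕ) (hP : ∀ x ∈ P, x ≤ 2 * n)
    (a₁ b₁ a₂ b₂ : ℕ) (h₁ : (a₁, b₁) ∈ B) (h₂ : (a₂, b₂) ∈ B)
    (ha : a₁ < a₂) (hm : a₂ < b₂) (hb : b₂ < b₁) :
    ((∀ i : ℕ, i ≤ a₂ - a₁ → (a₁ + i, b₁ - i) ∈ B) ∧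
        ¬∃ x ∈ P, (a₁ ≤ x ∧ x < a₂) ∨ (b₂ ≤ x ∧ x < b₁)) ∨
      (∃ x ∈ P, (a₁ ≤ x ∧ x < a₂) ∨ (b₂ ≤ x ∧ x < b₁)) ∨
      (∃ c : ℕ, ((a₁ ≤ c ∧ c ≤ a₂ - 1) ∨ (b₂ ≤ c ∧ c ≤ b₁ - 1)) ∧ (c, c + 1) ∈ B) := by
  by_cases hmark : ∃ x ∈ P, (a₁ ≤ x ∧ x < a₂) ∨ (b₂ ≤ x ∧ x < b₁)
  · exact Or.inr (Or.inl hmark)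
  by_cases hone : ∃ c : ℕ, ((a₁ ≤ c ∧ c ≤ a₂ - 1) ∨ (b₂ ≤ c ∧ c ≤ b₁ - 1)) ∧ (c, c + 1) ∈ B
  · exact Or.inr (Or.inr hone)
  refine Or.inl ⟨?_, hmark⟩
  obtain ⟨hB1, hB2, hB3⟩ := hB
  have hr : ∀ p q, (p, q) ∈ B → 1 ≤ p ∧ p < q ∧ q ≤ 2 * n := fun p q h => hB1 _ h
  have hex : ∀ c, 1 ≤ c → c ≤ 2 * n → ∃ d, (c, d) ∈ B ∨ (d, c) ∈ B := by
    intro c h1 h2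
    obtain ⟨⟨p, q⟩, ⟨hpq, h⟩, -⟩ := hB2 c h1 h2
    rcases h with h | h
    · exact ⟨q, Or.inl (by simpa [← h] using hpq)⟩
    · exact ⟨p, Or.inr (by simpa [← h] using hpq)⟩
  have hx : ∀ p q r s, (p, q) ∈ B → (r, s) ∈ B → ¬ (p < r ∧ r < q ∧ q < s) :=
    fun p q r s h h' => hB3 _ h _ h'
  have hu : ∀ p q r s, (p, q) ∈ B → (r, s) ∈ B → (p = r ∨ p = s ∨ q = r ∨ q = s) →
      p = r ∧ q = s := by
    intro p q r s h h' he
    have h1 := hr _ _ h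
    have h2 := hr _ _ h'
    have key : ∀ c, (p = c ∨ q = c) → (r = c ∨ s = c) → p = r ∧ q = s := by
      intro c hc hc'
      have := (hB2 c (by omega) (by omega)).unique (y₁ := (p, q)) (y₂ := (r, s))
        ⟨h, hc⟩ ⟨h', hc'⟩
      simpa using this
    rcases he with he | he | he | he
    · exact key p (by omega) (by omega)
    · exact key p (by omega) (by omega)
    · exact key q (by omega) (by omega)
    · exact key q (by omega) (by omega)
  have hno : ∀ p q, (p, q) ∈ B → ¬ ((a₁ ≤ p ∧ q ≤ a₂) ∨ (b₂ ≤ p ∧ q ≤ b₁)) := by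
    intro p q hpq h
    obtain ⟨c, hc1, hc2, hc⟩ := band_width_one hr hex hx hu _ p q le_rfl hpq
    exact hone ⟨c, by omega, hc⟩
  have hr1 := hr _ _ h₁
  have hr2 := hr _ _ h₂
  intro i
  induction i with
  | zero => intro _; simpa using h₁
  | succ i ih =>
    intro hi
    have hI := ih (by omega)
    have k1 := hr _ _ hI
    have k2 := hx _ _ _ _ hI h₂
    have k3 := hu _ _ _ _ hI h₂
    have k4 := hno _ _ hI
    have hbi : b₂ < b₁ - i := by omega
    -- the partner of `a₁ + i + 1`
    obtain ⟨w, hw, hw1, hw2⟩ : ∃ w, (a₁ + (i + 1), w) ∈ B ∧ b₂ ≤ w ∧ w < b₁ - i := by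
      obtain ⟨w, hw | hw⟩ := hex (a₁ + (i + 1)) (by omega) (by omega)
      · have e1 := hr _ _ hw
        have e2 := hx _ _ _ _ hI hw
        have e3 := hu _ _ _ _ hI hw
        have e4 := hno _ _ hw
        have e5 := hx _ _ _ _ hw h₂
        have e6 := hu _ _ _ _ hw h₂
        exact ⟨w, hw, by omega, by omega⟩
      · exfalso
        have e1 := hr _ _ hw
        have e2 := hx _ _ _ _ hw hI
        have e3 := hu _ _ _ _ hI hw
        have e4 := hno _ _ hw
        omega
    have hwy : w = b₁ - (i + 1) := by
      by_contra hne
      obtain ⟨z, hz | hz⟩ := hex (b₁ - (i + 1)) (by omega) (by omega)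
      · have e1 := hr _ _ hz
        have e2 := hx _ _ _ _ hI hz
        have e3 := hu _ _ _ _ hI hz
        omega
      · have e1 := hr _ _ hz
        have e2 := hx _ _ _ _ hz hI
        have e3 := hu _ _ _ _ hI hz
        have e4 := hno _ _ hz
        have e5 := hx _ _ _ _ hw hz
        have e6 := hu _ _ _ _ hw hz
        omega
    rw [← hwy]; exact hw
end
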